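/- Let k be a Poisson random variable with mean λ > 0 and let g : ℕ → ℝ be bounded. Then the map λ ↦ E[g(k)] = ∑_{n≥0} e^{−λ} λ^n g(n)/n! is differentiable and d/dλ E[g(k)] = E[g(k+1) − g(k)]. -/

import Mathlib

/-- The Poisson probability mass function with mean `lam`: `P(k = n) = e^{-lam} lam^n / n!`. -/
noncomputable def pois (lam : ℝ) (k : ℕ) : ℝ := Real.exp (-lam) * lam ^ k / (Nat.factorial k)

lemma summable_pow_div_factorial_mul {g : ℕ → ℝ} {C : ℝ} (hg : ∀ n, |g n| ≤ C) (x : ℝ) :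
    Summable fun n : ℕ => x ^ n / n.factorial * g n := by
  refine Summable.of_norm_bounded
    (g := fun n : ℕ => |x| ^ n / n.factorial * C)
    ((Real.summable_pow_div_factorial |x|).mul_right C) fun n => ?_
  rw [norm_mul, norm_div, norm_pow, Real.norm_natCast, Real.norm_eq_abs, Real.norm_eq_abs]
  exact mul_le_mul_of_nonneg_left (hg n) (by positivity)

lemma succ_mul_pow_div_factorial_succ (x : ℝ) (n : ℕ) :
    ((n + 1 : ℕ) : ℝ) * x ^ (n + 1 - 1) / (n + 1).factorial = x ^ n / n.factorial := by
  rw [Nat.factorial_succ, Nat.add_sub_cancel, Nat.cast_mul]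
  exact mul_div_mul_left _ _ (Nat.cast_ne_zero.mpr n.succ_ne_zero)

/-- An exponential generating function with bounded coefficients is differentiable, and its
derivative is the exponential generating function of the shifted coefficients. -/
lemma hasDerivAt_tsum_pow_div_factorial_mul {g : ℕ → ℝ} {C : ℝ} (hg : ∀ n, |g n| ≤ C) (x : ℝ) :
    HasDerivAt (fun y : ℝ => ∑' n : ℕ, y ^ n / n.factorial * g n)
      (∑' n : ℕ, x ^ n / n.factorial * g (n + 1)) x := by
  set R : ℝ := |x| + 1
  have hu : Summable fun n : ℕ => (n : ℝ) * R ^ (n - 1) / n.factorial * C := by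
    rw [← summable_nat_add_iff 1]
    simp only [succ_mul_pow_div_factorial_succ]
    exact (Real.summable_pow_div_factorial R).mul_right C
  have hbound : ∀ (n : ℕ) (y : ℝ), y ∈ Metric.ball (0 : ℝ) R →
      ‖(n : ℝ) * y ^ (n - 1) / n.factorial * g n‖ ≤
        (n : ℝ) * R ^ (n - 1) / n.factorial * C := by
    intro n y hy
    have hyR : |y| ≤ R := by simpa using (mem_ball_zero_iff.mp hy).le
    simp only [norm_mul, norm_div, norm_pow, Real.norm_eq_abs, Nat.abs_cast]
    gcongr
    exact hg n
  have hx : x ∈ Metric.ball (0 : ℝ) R := by simp [R]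
  have hderiv := hasDerivAt_tsum_of_isPreconnected hu Metric.isOpen_ball
    (convex_ball (0 : ℝ) R).isPreconnected
    (fun n y _ => ((hasDerivAt_pow n y).div_const (n.factorial : ℝ)).mul_const (g n))
    hbound hx (summable_pow_div_factorial_mul hg x) hx
  convert! hderiv using 1
  rw [(Summable.of_norm_bounded hu fun n => hbound n x hx).tsum_eq_zero_add]
  simp only [succ_mul_pow_div_factorial_succ]
  simp

lemma tsum_pois_mul (l : ℝ) (g : ℕ → ℝ) :
    ∑' n : ℕ, pois l n * g n = Real.exp (-l) * ∑' n : ℕ, l ^ n / n.factorial * g n := by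
  simp only [pois, mul_div_assoc, mul_assoc, tsum_mul_left]

/-- For a Poisson random variable `k` with mean `lam > 0` and a bounded `g : ℕ → ℝ`, the map
`lam ↦ E[g(k)] = ∑_{n≥0} e^{-lam} lam^n g(n)/n!` is differentiable and its derivative is
`E[g(k+1) - g(k)]`. -/
theorem poisson_deriv (lam : ℝ) (hlam : 0 < lam) (g : ℕ → ℝ)
    (hg : ∃ C : ℝ, ∀ n : ℕ, |g n| ≤ C) :
    HasDerivAt (fun l : ℝ => ∑' n : ℕ, pois l n * g n)
      (∑' n : ℕ, pois lam n * (g (n + 1) - g n)) lam := by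
  obtain ⟨C, hC⟩ := hg
  rw [tsum_pois_mul lam fun n => g (n + 1) - g n]
  simp only [tsum_pois_mul, mul_sub (_ / _)]
  rw [(summable_pow_div_factorial_mul (fun n => hC (n + 1)) lam).tsum_sub
    (summable_pow_div_factorial_mul hC lam)]
  convert! (hasDerivAt_neg lam).exp.mul (hasDerivAt_tsum_pow_div_factorial_mul hC lam) using 1
  ring
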